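/- arXiv:2402.01358 — 4 statements merged into one kernel-verified Lean document; each statement's English description precedes it below -/
import Mathlib

section
/- Let G be a finite group, N a normal subgroup of G, and p a prime. Suppose M is a subgroup of N ∩ Z(G) with |M| = p. Then |S_p^{G/M}(N/M)| · p = |S_p^G(N)|, where S_p^{G/M}(N/M) is computed in the quotient group G/M with the normal subgroup N/M. -/
theorem normal_of_le_center {G : Type*} [Group G] (H : Subgroup G)
    (h : H ≤ Subgroup.center G) : H.Normal := by
  refine ⟨fun a ha g => ?_⟩
  have := (Subgroup.mem_center_iff.mp (h ha)) g
  rw [this]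
  simpa using ha

open Subgroup in
/-- The centralizer of `g` has index dividing `|M|` in the full preimage of the centralizer of the
image of `g` in `G ⧸ M`, when `M` is central. -/
theorem relIndex_centralizer_dvd_card {G : Type*} [Group G] (M : Subgroup G) [M.Normal]
    (hM : M ≤ center G) (g : G) :
    (centralizer {g}).relIndex
      ((centralizer {(g : G ⧸ M)}).comap (QuotientGroup.mk' M)) ∣ Nat.card M := by
  set C := (centralizer {(g : G ⧸ M)}).comap (QuotientGroup.mk' M)
  have hmem (x : C) : (x : G) * g * (x : G)⁻¹ * g⁻¹ ∈ M := by
    have hx := mem_centralizer_singleton_iff.mp (mem_comap.mp x.2)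
    rw [← QuotientGroup.eq_one_iff]
    simp only [QuotientGroup.mk'_apply] at hx
    simp [hx]
  let φ : C →* M :=
    { toFun x := ⟨(x : G) * g * (x : G)⁻¹ * g⁻¹, hmem x⟩
      map_one' := by simp
      map_mul' x y := by
        ext
        have hy := mem_center_iff.mp (hM (hmem y)) x
        simp only [Subgroup.coe_mul, mul_inv_rev]
        calc (x : G) * y * g * ((y : G)⁻¹ * (x : G)⁻¹) * g⁻¹
            = (x : G) * (y * g * (y : G)⁻¹ * g⁻¹) * (g * (x : G)⁻¹ * g⁻¹) := by group
          _ = y * g * (y : G)⁻¹ * g⁻¹ * (x * g * (x : G)⁻¹ * g⁻¹) := by rw [hy]; group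
          _ = _ := by
            have hc := mem_center_iff.mp (hM (hmem x)) (y * g * (y : G)⁻¹ * g⁻¹)
            exact hc }
  have hker : (centralizer {g}).subgroupOf C = φ.ker := by
    ext x
    rw [mem_subgroupOf, mem_centralizer_singleton_iff, MonoidHom.mem_ker, Subtype.ext_iff]
    change _ ↔ (x : G) * g * (x : G)⁻¹ * g⁻¹ = 1
    rw [mul_inv_eq_one, mul_inv_eq_iff_eq_mul]
  rw [relIndex, hker, index_ker]
  exact card_subgroup_dvd_card φ.range

open Subgroup in
theorem exists_index_centralizer_mk_eq_pow_iff {G : Type*} [Group G] {p : ℕ} (hp : p.Prime)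
    (M : Subgroup G) [M.Normal] (hM : M ≤ center G) (hcard : Nat.card M = p) (g : G) :
    (∃ k, (centralizer {(g : G ⧸ M)}).index = p ^ k) ↔
      ∃ k, (centralizer {g}).index = p ^ k := by
  have hle : centralizer {g} ≤
      (centralizer {(g : G ⧸ M)}).comap (QuotientGroup.mk' M) := by
    intro x hx
    rw [mem_centralizer_singleton_iff] at hx
    rw [mem_comap, mem_centralizer_singleton_iff, QuotientGroup.mk'_apply,
      ← QuotientGroup.mk_mul, hx, QuotientGroup.mk_mul]
  have hindex := relIndex_mul_index hle
  rw [index_comap_of_surjective _ (QuotientGroup.mk'_surjective M)] at hindex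
  have hdvd := relIndex_centralizer_dvd_card M hM g
  rw [hcard, ← pow_one p, Nat.dvd_prime_pow hp] at hdvd
  obtain ⟨j, -, hj⟩ := hdvd
  rw [hj] at hindex
  constructor
  · rintro ⟨k, hk⟩
    exact ⟨j + k, by rw [← hindex, hk, pow_add]⟩
  · rintro ⟨k, hk⟩
    obtain ⟨i, -, hi⟩ := (Nat.dvd_prime_pow hp).mp (hk ▸ Dvd.intro_left _ hindex)
    exact ⟨i, hi⟩

/-- If M ≤ N ∩ Z(G) with |M| = p, then |S_p^{G/M}(N/M)| · p = |S_p^G(N)|. -/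
theorem stmt_5 {G : Type*} [Group G] [Finite G] (N : Subgroup G) (hN : N.Normal)
    (p : ℕ) (hp : p.Prime) (M : Subgroup G)
    (hM : M ≤ N ⊓ Subgroup.center G) (hMcard : Nat.card ↥M = p) :
    haveI : M.Normal := normal_of_le_center M (hM.trans inf_le_right)
    Nat.card {x : G ⧸ M | x ∈ N.map (QuotientGroup.mk' M) ∧
        ∃ k, (Subgroup.centralizer {x}).index = p ^ k} * p
      = Nat.card {g : G | g ∈ N ∧ ∃ k, (Subgroup.centralizer {g}).index = p ^ k} := by
  have hnormal : M.Normal := normal_of_le_center M (hM.trans inf_le_right)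
  have hmap (g : G) : (g : G ⧸ M) ∈ N.map (QuotientGroup.mk' M) ↔ g ∈ N := by
    rw [← QuotientGroup.mk'_apply, ← Subgroup.mem_comap, Subgroup.comap_map_eq_self]
    simpa using hM.trans inf_le_left
  have hpre : {g : G | g ∈ N ∧ ∃ k, (Subgroup.centralizer {g}).index = p ^ k} =
      QuotientGroup.mk ⁻¹' {x : G ⧸ M | x ∈ N.map (QuotientGroup.mk' M) ∧
        ∃ k, (Subgroup.centralizer {x}).index = p ^ k} := by
    ext g
    exact and_congr (hmap g).symm (exists_index_centralizer_mk_eq_pow_iff hp M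
      (hM.trans inf_le_right) hMcard g).symm
  rw [hpre, Nat.card_congr (QuotientGroup.preimageMkEquivSubgroupProdSet M _), Nat.card_prod,
    hMcard, mul_comm]
end

section
/- Let G be a finite group, N a normal subgroup of G, and p a prime. Then |S_p^G(N)| ≡ |N ∩ Z(G)| (mod p). -/
theorem Subgroup.index_centralizer_conj {G : Type*} [Group G] (x g : G) :
    (Subgroup.centralizer {x * g * x⁻¹}).index = (Subgroup.centralizer {g}).index := by
  have h : Subgroup.centralizer {g} =
      (Subgroup.centralizer {x * g * x⁻¹}).comap (MulAut.conj x).toMonoidHom := by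
    ext y
    rw [Subgroup.mem_comap, Subgroup.mem_centralizer_singleton_iff,
      Subgroup.mem_centralizer_singleton_iff, MulEquiv.coe_toMonoidHom, ← MulAut.conj_apply x g,
      ← map_mul, ← map_mul, (MulAut.conj x).injective.eq_iff]
  rw [h, Subgroup.index_comap_of_surjective _ (MulAut.conj x).surjective]

/-- A Sylow `p`-subgroup acts by conjugation on the elements of `N` with class size a power of `p`;
its fixed points there are exactly the central elements in `N`. -/
theorem stmt_6 {G : Type*} [Group G] [Finite G] (N : Subgroup G) (hN : N.Normal)
    (p : ℕ) (hp : p.Prime) :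
    Nat.card {g : G | g ∈ N ∧ ∃ k, (Subgroup.centralizer {g}).index = p ^ k}
      ≡ Nat.card ↥(N ⊓ Subgroup.center G) [MOD p] := by
  have : Fact p.Prime := ⟨hp⟩
  set S := {g : G | g ∈ N ∧ ∃ k, (Subgroup.centralizer {g}).index = p ^ k}
  obtain ⟨P⟩ : Nonempty (Sylow p G) := inferInstance
  let : MulAction P S :=
    { smul x s := ⟨x * s * (x : G)⁻¹, hN.conj_mem _ s.2.1 x, by
        rw [Subgroup.index_centralizer_conj]; exact s.2.2⟩
      one_smul s := Subtype.ext (show ((1 : P) : G) * s * ((1 : P) : G)⁻¹ = s by simp)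
      mul_smul x y s := Subtype.ext
        (show ((x * y : P) : G) * s * ((x * y : P) : G)⁻¹ =
          x * (y * s * (y : G)⁻¹) * (x : G)⁻¹ by simp [mul_assoc]) }
  have smul_eq_iff (x : P) (s : S) : x • s = s ↔ (x : G) * s = s * x := by
    rw [Subtype.ext_iff, ← mul_inv_eq_iff_eq_mul]
    exact Iff.rfl
  refine (P.isPGroup'.card_modEq_card_fixedPoints S).trans (congrArg (· % p) ?_)
  have central_of_fixed (s : S) (hs : s ∈ MulAction.fixedPoints P S) :
      (s : G) ∈ Subgroup.center G := by
    obtain ⟨k, hk⟩ := s.2.2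
    have hle : (P : Subgroup G) ≤ Subgroup.centralizer {(s : G)} := fun x hx =>
      Subgroup.mem_centralizer_singleton_iff.2 ((smul_eq_iff ⟨x, hx⟩ s).1 (hs _))
    have hndvd : ¬ p ∣ (Subgroup.centralizer {(s : G)}).index := fun h =>
      P.not_dvd_index (h.trans (Subgroup.index_dvd_of_le hle))
    have hk0 : k = 0 := by
      by_contra h
      exact hndvd (hk ▸ dvd_pow_self p h)
    rw [hk0, pow_zero, Subgroup.index_eq_one] at hk
    refine Subgroup.mem_center_iff.2 fun x => ?_
    exact Subgroup.mem_centralizer_singleton_iff.1 (hk ▸ Subgroup.mem_top x)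
  refine Nat.card_congr
    { toFun s := ⟨s.1, s.1.2.1, central_of_fixed s.1 s.2⟩
      invFun z := ⟨⟨z, z.2.1, 0, ?_⟩, fun x => ?_⟩
      left_inv _ := rfl
      right_inv _ := rfl }
  · rw [pow_zero, Subgroup.index_eq_one, eq_top_iff]
    exact fun x _ => Subgroup.mem_centralizer_singleton_iff.2 (Subgroup.mem_center_iff.1 z.2.2 x)
  · exact (smul_eq_iff _ _).2 (Subgroup.mem_center_iff.1 z.2.2 x)
end

section
/- Let G be a finite group, N a normal subgroup of G, and p a prime. Then the order of C_N(O^{p'}(G)) divides the cardinality of S_{p'}^G(N), where O^{p'}(G) is the subgroup of G generated by all Sylow p-subgroups of G and C_N(O^{p'}(G)) = N ∩ C_G(O^{p'}(G)). -/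
/-- The index of a subgroup is prime to `p` iff the subgroup contains a Sylow `p`-subgroup. -/
theorem Subgroup.not_dvd_index_iff_exists_sylow_le {G : Type*} [Group G] [Finite G]
    {p : ℕ} [hp : Fact p.Prime] (H : Subgroup G) :
    ¬ p ∣ H.index ↔ ∃ P : Sylow p G, (P : Subgroup G) ≤ H := by
  constructor
  · intro h
    obtain ⟨Q⟩ : Nonempty (Sylow p H) := inferInstance
    have hQ : ¬ p ∣ ((Q : Subgroup H).map H.subtype).index := by
      rw [Subgroup.index_map_subtype, hp.out.dvd_mul]
      exact not_or_intro Q.not_dvd_index h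
    exact ⟨(Q.isPGroup'.map H.subtype).toSylow hQ, Subgroup.map_subtype_le _⟩
  · rintro ⟨P, hP⟩ h
    exact P.not_dvd_index (h.trans (Subgroup.index_dvd_of_le hP))

/-- The order of a subgroup divides the size of any set stable under right multiplication by it. -/
theorem Subgroup.card_dvd_card_of_mul_mem {G : Type*} [Group G] (C : Subgroup G) (s : Set G)
    (h : ∀ g ∈ s, ∀ z ∈ C, g * z ∈ s) : Nat.card C ∣ Nat.card s := by
  have hs : (QuotientGroup.mk : G → G ⧸ C) ⁻¹' (QuotientGroup.mk '' s) = s := by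
    refine Set.Subset.antisymm ?_ (Set.subset_preimage_image _ _)
    rintro x ⟨g, hg, hgx⟩
    simpa using h g hg _ (QuotientGroup.eq.mp hgx)
  rw [← hs, Nat.card_congr (QuotientGroup.preimageMkEquivSubgroupProdSet C _), Nat.card_prod]
  exact dvd_mul_right _ _

/-- |C_N(O^{p'}(G))| divides |S_{p'}^G(N)|, where O^{p'}(G) is generated by all
Sylow p-subgroups of G. -/
theorem stmt_11 {G : Type*} [Group G] [Finite G] (N : Subgroup G) (hN : N.Normal)
    (p : ℕ) (hp : p.Prime) :
    Nat.card ↥(N ⊓ Subgroup.centralizer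
        ((Subgroup.closure (⋃ P : Sylow p G, ((P : Subgroup G) : Set G)) : Subgroup G) : Set G))
      ∣ Nat.card {g : G | g ∈ N ∧ ¬ p ∣ (Subgroup.centralizer {g}).index} := by
  have : Fact p.Prime := ⟨hp⟩
  apply Subgroup.card_dvd_card_of_mul_mem
  rintro g ⟨hgN, hg⟩ z ⟨hzN, hz⟩
  refine ⟨N.mul_mem hgN hzN, ?_⟩
  rw [Subgroup.not_dvd_index_iff_exists_sylow_le] at hg ⊢
  obtain ⟨P, hP⟩ := hg
  refine ⟨P, fun x hx => ?_⟩
  have hxg : Commute x g := (Subgroup.mem_centralizer_singleton_iff.mp (hP hx))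
  have hxz : Commute x z := Subgroup.mem_centralizer_iff.mp hz x
    (Subgroup.subset_closure (Set.mem_iUnion.mpr ⟨P, hx⟩))
  exact Subgroup.mem_centralizer_singleton_iff.mpr (hxg.mul_right hxz)
end

section
/- Let G be a finite group and N a normal subgroup of G. Then N is contained in the hypercentre Z_∞(G) if and only if for every prime p, |S_p^G(N)|_p = |N|_p. -/
section

open Subgroup
open scoped commutatorElement

/-- The elements of `N` whose conjugacy class in `G` has size a power of `p`. -/
def primePowerClassSet {G : Type*} [Group G] (N : Subgroup G) (p : ℕ) : Set G :=
  {g : G | g ∈ N ∧ ∃ k, (Subgroup.centralizer {g}).index = p ^ k}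

theorem mem_iSup_upperCentralSeries {G : Type*} [Group G] {x : G} :
    x ∈ ⨆ n, Subgroup.upperCentralSeries G n ↔ ∃ n, x ∈ Subgroup.upperCentralSeries G n :=
  mem_iSup_of_directed (Subgroup.upperCentralSeries_mono G).directed_le

theorem centralizer_index_eq_one_iff {G : Type*} [Group G] {g : G} :
    (centralizer {g}).index = 1 ↔ g ∈ center G := by
  simp [index_eq_one, centralizer_eq_top_iff_subset]

theorem centralizer_singleton_index_conj {G : Type*} [Group G] (x g : G) :
    (centralizer {x * g * x⁻¹}).index = (centralizer {g}).index := by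
  have h : (centralizer {x * g * x⁻¹}).comap (MulAut.conj x).toMonoidHom = centralizer {g} := by
    ext y
    simp only [mem_comap, mem_centralizer_singleton_iff, MulEquiv.coe_toMonoidHom,
      MulAut.conj_apply]
    constructor
    · intro h
      have := congrArg (fun z => x⁻¹ * z * x) h
      simpa [mul_assoc] using this
    · intro h
      have := congrArg (fun z => x * z * x⁻¹) h
      simpa [mul_assoc] using this
  rw [← h, index_comap_of_surjective _ (MulAut.conj x).surjective]

theorem conj_mem_primePowerClassSet {G : Type*} [Group G] {N : Subgroup G} [N.Normal] {p : ℕ}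
    {g : G} (hg : g ∈ primePowerClassSet N p) (x : G) :
    x * g * x⁻¹ ∈ primePowerClassSet N p :=
  ⟨Normal.conj_mem inferInstance g hg.1 x, by
    rw [centralizer_singleton_index_conj]; exact hg.2⟩

/-- Conjugation by a subgroup on the elements of `N` with class size a power of `p`. -/
@[reducible] def conjActionPrimePowerClassSet {G : Type*} [Group G] (N : Subgroup G) [N.Normal]
    (p : ℕ) (P : Subgroup G) : MulAction P (primePowerClassSet N p) where
  smul x g := ⟨x * g * (x : G)⁻¹, conj_mem_primePowerClassSet g.2 x⟩
  one_smul g := Subtype.ext (by change ((1 : P) : G) * g * ((1 : P) : G)⁻¹ = g; simp)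
  mul_smul x y g := Subtype.ext (by
    change ((x * y : P) : G) * g * ((x * y : P) : G)⁻¹ = x * (y * g * (y : G)⁻¹) * (x : G)⁻¹
    simp [mul_assoc])

theorem mem_center_of_primePowerClass {G : Type*} [Group G] [Finite G] {p : ℕ} [Fact p.Prime]
    (P : Sylow p G) {g : G} (hg : ∃ k, (centralizer {g}).index = p ^ k)
    (hP : (P : Subgroup G) ≤ centralizer {g}) : g ∈ center G := by
  obtain ⟨k, hk⟩ := hg
  rw [← centralizer_index_eq_one_iff]
  rcases Nat.eq_zero_or_pos k with rfl | hk0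
  · simpa using hk
  · have h : p ∣ (P : Subgroup G).index :=
      ((dvd_pow_self p hk0.ne').trans hk.symm.dvd).trans (index_dvd_of_le hP)
    exact (P.not_dvd_index h).elim

theorem card_primePowerClassSet_modEq {G : Type*} [Group G] [Finite G] (N : Subgroup G)
    [N.Normal] (p : ℕ) [Fact p.Prime] :
    Nat.card (primePowerClassSet N p) ≡ Nat.card ↥(N ⊓ center G) [MOD p] := by
  obtain ⟨P⟩ : Nonempty (Sylow p G) := inferInstance
  let := conjActionPrimePowerClassSet N p P
  have h := P.isPGroup'.card_modEq_card_fixedPoints (primePowerClassSet N p)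
  refine h.trans (congrArg (· % p) (Nat.card_congr ?_))
  refine
    { toFun g := ⟨g.1.1, g.1.2.1, mem_center_of_primePowerClass P g.1.2.2 ?_⟩
      invFun g := ⟨⟨g.1, g.2.1, 0, ?_⟩, ?_⟩
      left_inv _ := rfl
      right_inv _ := rfl }
  · intro x hx
    have : x * g.1.1 * x⁻¹ = g.1.1 := congrArg Subtype.val (g.2 ⟨x, hx⟩)
    rw [mem_centralizer_singleton_iff]
    simpa [eq_comm] using mul_inv_eq_iff_eq_mul.1 this
  · rw [pow_zero]
    exact centralizer_index_eq_one_iff.2 g.2.2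
  · intro x
    refine Subtype.ext (?_ : (x : G) * g.1 * (x : G)⁻¹ = g.1)
    rw [mem_center_iff.1 g.2.2 x, mul_inv_cancel_right]

theorem relIndex_centralizer_comap_dvd {G : Type*} [Group G] [Finite G] (Z : Subgroup G)
    [Z.Normal] (hZ : Z ≤ center G) (g : G) :
    (centralizer {g}).relIndex ((centralizer {(g : G ⧸ Z)}).comap (QuotientGroup.mk' Z)) ∣
      Nat.card Z := by
  let D := (centralizer {(g : G ⧸ Z)}).comap (QuotientGroup.mk' Z)
  have hmem : ∀ d : D, g * d * g⁻¹ * (d : G)⁻¹ ∈ Z := by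
    intro d
    have h : (d : G) ∈ (centralizer {(g : G ⧸ Z)}).comap (QuotientGroup.mk' Z) := d.2
    rw [mem_comap, mem_centralizer_singleton_iff] at h
    rw [← QuotientGroup.eq_one_iff]
    change (g : G ⧸ Z) * ((d : G) : G ⧸ Z) * (g : G ⧸ Z)⁻¹ * ((d : G) : G ⧸ Z)⁻¹ = 1
    change ((d : G) : G ⧸ Z) * (g : G ⧸ Z) = (g : G ⧸ Z) * ((d : G) : G ⧸ Z) at h
    rw [← h]
    group
  let f : D →* Z :=
    { toFun d := ⟨g * d * g⁻¹ * (d : G)⁻¹, hmem d⟩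
      map_one' := Subtype.ext (by simp)
      map_mul' d e := Subtype.ext (by
        have h := mem_center_iff.1 (hZ (hmem e)) ((d : G)⁻¹)
        have h2 : g * ((d * e : D) : G) * g⁻¹ * ((d * e : D) : G)⁻¹ =
            g * d * g⁻¹ * ((g * e * g⁻¹ * (e : G)⁻¹) * (d : G)⁻¹) := by
          simp [mul_assoc]
        change g * ((d * e : D) : G) * g⁻¹ * ((d * e : D) : G)⁻¹ =
          (g * d * g⁻¹ * (d : G)⁻¹) * (g * e * g⁻¹ * (e : G)⁻¹)
        rw [h2, ← h]
        simp [mul_assoc]) }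
  have hker : f.ker = (centralizer {g}).subgroupOf D := by
    ext d
    rw [MonoidHom.mem_ker, mem_subgroupOf, mem_centralizer_singleton_iff, Subtype.ext_iff]
    change g * d * g⁻¹ * (d : G)⁻¹ = 1 ↔ _
    rw [mul_inv_eq_one, mul_inv_eq_iff_eq_mul, eq_comm]
  change ((centralizer {g}).subgroupOf D).index ∣ _
  rw [← hker, index_ker]
  exact card_subgroup_dvd_card _

theorem primePowerClass_quotient_iff {G : Type*} [Group G] [Finite G] {p : ℕ} (hp : p.Prime)
    (Z : Subgroup G) [Z.Normal] (hZ : Z ≤ center G) (hcard : Nat.card Z = p) (g : G) :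
    (∃ k, (centralizer {(g : G ⧸ Z)}).index = p ^ k) ↔
      ∃ k, (centralizer {g}).index = p ^ k := by
  set D := (centralizer {(g : G ⧸ Z)}).comap (QuotientGroup.mk' Z) with hD
  have hidx : D.index = (centralizer {(g : G ⧸ Z)}).index :=
    index_comap_of_surjective _ (QuotientGroup.mk'_surjective Z)
  have hle : centralizer {g} ≤ D := by
    intro x hx
    rw [mem_centralizer_singleton_iff] at hx
    rw [hD, mem_comap, mem_centralizer_singleton_iff]
    exact congrArg (QuotientGroup.mk' Z) hx
  have hmul := relIndex_mul_index hle
  rw [← hidx]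
  constructor
  · rintro ⟨k, hk⟩
    have h := relIndex_centralizer_comap_dvd Z hZ g
    rw [hcard, ← hD] at h
    have h2 : (centralizer {g}).index ∣ p ^ (k + 1) := by
      rw [← hmul, hk, pow_succ']
      exact mul_dvd_mul_right h _
    obtain ⟨m, -, hm⟩ := (Nat.dvd_prime_pow hp).1 h2
    exact ⟨m, hm⟩
  · rintro ⟨k, hk⟩
    obtain ⟨m, -, hm⟩ := (Nat.dvd_prime_pow hp).1 (hk ▸ index_dvd_of_le hle)
    exact ⟨m, hm⟩

theorem card_primePowerClassSet_quotient {G : Type*} [Group G] [Finite G] {p : ℕ}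
    (hp : p.Prime) (N Z : Subgroup G) [Z.Normal] (hZN : Z ≤ N) (hZ : Z ≤ center G)
    (hcard : Nat.card Z = p) :
    Nat.card (primePowerClassSet N p) =
      p * Nat.card (primePowerClassSet (N.map (QuotientGroup.mk' Z)) p) := by
  have h : primePowerClassSet N p =
      ((↑) : G → G ⧸ Z) ⁻¹' primePowerClassSet (N.map (QuotientGroup.mk' Z)) p := by
    ext g
    have h1 : (g : G ⧸ Z) ∈ N.map (QuotientGroup.mk' Z) ↔ g ∈ N := by
      change g ∈ (N.map (QuotientGroup.mk' Z)).comap (QuotientGroup.mk' Z) ↔ _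
      rw [comap_map_eq_self (by simpa using hZN)]
    exact (and_congr h1 (primePowerClass_quotient_iff hp Z hZ hcard g)).symm
  rw [h, Nat.card_congr (QuotientGroup.preimageMkEquivSubgroupProdSet _ _), Nat.card_prod, hcard]

theorem card_eq_mul_card_map_mk {G : Type*} [Group G] [Finite G] (N Z : Subgroup G) [Z.Normal]
    (hZN : Z ≤ N) :
    Nat.card N = Nat.card Z * Nat.card (N.map (QuotientGroup.mk' Z)) := by
  have h : (N : Set G) = ((↑) : G → G ⧸ Z) ⁻¹' (N.map (QuotientGroup.mk' Z) : Set (G ⧸ Z)) := by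
    have := comap_map_eq_self (f := QuotientGroup.mk' Z) (H := N) (by simpa using hZN)
    exact congrArg SetLike.coe this.symm
  change Nat.card (N : Set G) = _
  rw [h, Nat.card_congr (QuotientGroup.preimageMkEquivSubgroupProdSet _ _), Nat.card_prod]
  rfl

theorem mem_upperCentralSeries_succ_of_mk {G : Type*} [Group G] (Z : Subgroup G) [Z.Normal]
    (hZ : Z ≤ center G) (n : ℕ) (x : G)
    (hx : (x : G ⧸ Z) ∈ Subgroup.upperCentralSeries (G ⧸ Z) n) : x ∈ Subgroup.upperCentralSeries G (n + 1) := by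
  induction n generalizing x with
  | zero =>
    rw [Subgroup.upperCentralSeries_zero, mem_bot, QuotientGroup.eq_one_iff] at hx
    rw [zero_add, Subgroup.upperCentralSeries_one]
    exact hZ hx
  | succ n ih =>
    rw [Subgroup.mem_upperCentralSeries_succ_iff] at hx ⊢
    exact fun y => ih _ (hx y)

theorem mk_mem_iSup_upperCentralSeries_iff {G : Type*} [Group G] (Z : Subgroup G) [Z.Normal]
    (hZ : Z ≤ center G) (x : G) :
    (x : G ⧸ Z) ∈ (⨆ n, Subgroup.upperCentralSeries (G ⧸ Z) n) ↔ x ∈ ⨆ n, Subgroup.upperCentralSeries G n := by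
  rw [mem_iSup_upperCentralSeries, mem_iSup_upperCentralSeries]
  constructor
  · rintro ⟨n, hn⟩
    exact ⟨n + 1, mem_upperCentralSeries_succ_of_mk Z hZ n x hn⟩
  · rintro ⟨n, hn⟩
    exact ⟨n, Subgroup.upperCentralSeries.map (QuotientGroup.mk'_surjective Z) n ⟨x, hn, rfl⟩⟩

theorem commutator_pow_mem_of_central_mod {G : Type*} [Group G] (H : Subgroup G) [H.Normal]
    {x g : G} {m : ℕ} (hx : x ^ m = 1) (hc : ∀ y, ⁅⁅x, g⁆, y⁆ ∈ H) : ⁅x, g⁆ ^ m ∈ H := by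
  rw [← QuotientGroup.eq_one_iff]
  set π := QuotientGroup.mk' H
  change π (⁅x, g⁆ ^ m) = 1
  have hcomm : Commute (π x)⁻¹ (π ⁅x, g⁆) := by
    have h : π ⁅⁅x, g⁆, x⁆ = 1 := (QuotientGroup.eq_one_iff _).2 (hc x)
    rw [map_commutatorElement, commutatorElement_eq_one_iff_commute] at h
    exact h.symm.inv_left
  have hxm : (π x) ^ m = 1 := by rw [← map_pow, hx, map_one]
  have h1 : π g * (π x)⁻¹ * (π g)⁻¹ = (π x)⁻¹ * π ⁅x, g⁆ := by
    rw [map_commutatorElement, commutatorElement_def]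
    group
  have h2 := congrArg (· ^ m) h1
  simp only [conj_pow, inv_pow, hxm, hcomm.mul_pow] at h2
  rw [map_pow]
  simpa using h2.symm

theorem exists_orderOf_eq_prime_mem_center {G : Type*} [Group G] [Finite G] (N : Subgroup G)
    [N.Normal] {p : ℕ} (hp : p.Prime) (n : ℕ) (x : G) (hxN : x ∈ N)
    (hx : x ∈ Subgroup.upperCentralSeries G n) (hord : orderOf x = p) :
    ∃ z ∈ N ⊓ center G, orderOf z = p := by
  induction n using Nat.strong_induction_on generalizing x with
  | _ n ih =>
  by_cases hex : ∃ k < n, ∃ y ∈ N, y ∈ Subgroup.upperCentralSeries G k ∧ orderOf y = p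
  · obtain ⟨k, hk, y, hyN, hyk, hy⟩ := hex
    exact ih k hk y hyN hyk hy
  refine ⟨x, ⟨hxN, mem_center_iff.2 fun g => ?_⟩, hord⟩
  have hcN : ⁅x, g⁆ ∈ N := by
    rw [commutatorElement_def, mul_assoc, mul_assoc, ← mul_assoc g]
    exact mul_mem hxN (Normal.conj_mem inferInstance _ (inv_mem hxN) g)
  have hstep : ∀ k < n, ⁅x, g⁆ ∈ Subgroup.upperCentralSeries G k → ⁅x, g⁆ = 1 := by
    intro k
    induction k with
    | zero => intro _ h; simpa using h
    | succ k ihk =>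
      intro hk hc
      refine ihk (by omega) ?_
      have hpow := commutator_pow_mem_of_central_mod (Subgroup.upperCentralSeries G k)
        (hord ▸ pow_orderOf_eq_one x) (Subgroup.mem_upperCentralSeries_succ_iff.1 hc)
      have hndvd : ¬ p ∣ orderOf ⁅x, g⁆ := by
        intro hd
        refine hex ⟨k + 1, hk, ⁅x, g⁆ ^ (orderOf ⁅x, g⁆ / p), pow_mem hcN _, pow_mem hc _, ?_⟩
        exact orderOf_pow_orderOf_div (orderOf_pos _).ne' hd
      obtain ⟨m, hm⟩ := exists_pow_eq_self_of_coprime ((hp.coprime_iff_not_dvd).2 hndvd)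
      rw [← hm]
      exact pow_mem hpow m
  have hc1 : ⁅x, g⁆ = 1 := by
    cases n with
    | zero =>
      have hx1 : x = 1 := by simpa using hx
      simp [hx1]
    | succ n => exact hstep n (by omega) (Subgroup.mem_upperCentralSeries_succ_iff.1 hx g)
  exact (commutatorElement_eq_one_iff_mul_comm.1 hc1).symm

theorem factorization_card_primePowerClassSet_eq_iff {p : ℕ} (hp : p.Prime) {G : Type*}
    [Group G] [Finite G] (N : Subgroup G) [N.Normal] :
    (Nat.card (primePowerClassSet N p)).factorization p = (Nat.card N).factorization p ↔
      ∀ x ∈ N, (∃ k, x ^ p ^ k = 1) → x ∈ ⨆ n, Subgroup.upperCentralSeries G n := by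
  have : Fact p.Prime := ⟨hp⟩
  induction hn : Nat.card G using Nat.strong_induction_on generalizing G with
  | _ n ih =>
  subst hn
  by_cases hcen : p ∣ Nat.card ↥(N ⊓ center G)
  · obtain ⟨⟨z, hz⟩, hzord⟩ := exists_prime_orderOf_dvd_card' p hcen
    rw [← orderOf_coe] at hzord
    change orderOf z = p at hzord
    set Z := zpowers z with hZdef
    have hcard : Nat.card Z = p := by rw [Nat.card_zpowers, hzord]
    have hZN : Z ≤ N := zpowers_le.2 hz.1
    have hZ : Z ≤ center G := zpowers_le.2 hz.2
    have : Z.Normal := ⟨fun x hx g => by rwa [mem_center_iff.1 (hZ hx) g, mul_inv_cancel_right]⟩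
    have : (N.map (QuotientGroup.mk' Z)).Normal :=
      Normal.map inferInstance _ (QuotientGroup.mk'_surjective Z)
    have hlt : Nat.card (G ⧸ Z) < Nat.card G := by
      have h1 := card_eq_card_quotient_mul_card_subgroup Z
      have h2 : 0 < Nat.card (G ⧸ Z) := Nat.card_pos
      rw [h1, hcard]
      exact lt_mul_of_one_lt_right h2 hp.one_lt
    have hIH := ih _ hlt (N.map (QuotientGroup.mk' Z)) rfl
    have hSne : Nat.card (primePowerClassSet (N.map (QuotientGroup.mk' Z)) p) ≠ 0 := by
      have : Nonempty (primePowerClassSet (N.map (QuotientGroup.mk' Z)) p) :=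
        ⟨1, one_mem _, 0, by rw [pow_zero]; exact centralizer_index_eq_one_iff.2 (one_mem _)⟩
      exact Nat.card_pos.ne'
    rw [card_primePowerClassSet_quotient hp N Z hZN hZ hcard, card_eq_mul_card_map_mk N Z hZN,
      hcard, Nat.factorization_mul hp.ne_zero hSne,
      Nat.factorization_mul hp.ne_zero Nat.card_pos.ne', Finsupp.add_apply, Finsupp.add_apply,
      Nat.add_left_cancel_iff]
    refine Iff.trans hIH ?_
    constructor
    · rintro h x hxN ⟨k, hk⟩
      refine (mk_mem_iSup_upperCentralSeries_iff Z hZ x).1 (h x ⟨x, hxN, rfl⟩ ⟨k, ?_⟩)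
      rw [← QuotientGroup.mk_pow, hk, QuotientGroup.mk_one]
    · rintro h _ ⟨x, hxN, rfl⟩ ⟨k, hk⟩
      refine (mk_mem_iSup_upperCentralSeries_iff Z hZ x).2 (h x hxN ⟨k + 1, ?_⟩)
      rw [← map_pow] at hk
      have hmem : x ^ p ^ k ∈ Z := (QuotientGroup.eq_one_iff _).1 hk
      have := pow_card_eq_one' (x := (⟨x ^ p ^ k, hmem⟩ : Z))
      rw [hcard] at this
      rw [pow_succ, pow_mul]
      exact congrArg Subtype.val this
  · have hS : (Nat.card (primePowerClassSet N p)).factorization p = 0 :=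
      Nat.factorization_eq_zero_of_not_dvd fun h =>
        hcen (((card_primePowerClassSet_modEq N p).dvd_iff dvd_rfl).1 h)
    rw [hS]
    by_cases hN : p ∣ Nat.card N
    · refine iff_of_false ?_ fun h => ?_
      · exact ((hp.factorization_pos_of_dvd Nat.card_pos.ne' hN).ne)
      · obtain ⟨⟨x, hxN⟩, hxord⟩ := exists_prime_orderOf_dvd_card' p hN
        rw [← orderOf_coe] at hxord
        change orderOf x = p at hxord
        obtain ⟨n, hxn⟩ := mem_iSup_upperCentralSeries.1
          (h x hxN ⟨1, by rw [pow_one, ← hxord, pow_orderOf_eq_one]⟩)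
        obtain ⟨z, hz, hzord⟩ := exists_orderOf_eq_prime_mem_center N hp n x hxN hxn hxord
        refine hcen (hzord ▸ ?_)
        rw [← orderOf_mk z hz]
        exact orderOf_dvd_natCard _
    · refine iff_of_true (Nat.factorization_eq_zero_of_not_dvd hN).symm ?_
      rintro x hxN ⟨k, hk⟩
      have hd : orderOf x ∣ Nat.card N := by
        rw [← orderOf_mk x hxN]
        exact orderOf_dvd_natCard _
      have hcop : (p ^ k).Coprime (Nat.card N) :=
        Nat.Coprime.pow_left k ((hp.coprime_iff_not_dvd).2 hN)
      have h1 : orderOf x = 1 := Nat.eq_one_of_dvd_coprimes hcop (orderOf_dvd_of_pow_eq_one hk) hd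
      rw [orderOf_eq_one_iff.1 h1]
      exact one_mem _

theorem le_of_forall_prime_pow_mem {G : Type*} [Group G] [Finite G] (N H : Subgroup G)
    (h : ∀ p : ℕ, p.Prime → ∀ x ∈ N, (∃ k, x ^ p ^ k = 1) → x ∈ H) : N ≤ H := by
  have key : ∀ m : ℕ, 0 < m → ∀ x ∈ N, x ^ m = 1 → x ∈ H := by
    intro m
    induction m using Nat.recOnPosPrimePosCoprime with
    | prime_pow p k hp _ => exact fun _ x hx hk => h p hp x hx ⟨k, hk⟩
    | zero => exact fun h0 => absurd h0 (lt_irrefl 0)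
    | one =>
      intro _ x _ hx
      rw [pow_one] at hx
      exact hx ▸ one_mem H
    | coprime a b ha hb hab iha ihb =>
      intro _ x hx hxab
      have h1 : x ^ a ∈ H := ihb (by omega) _ (pow_mem hx a) (by rw [← pow_mul, hxab])
      have h2 : x ^ b ∈ H := iha (by omega) _ (pow_mem hx b) (by rw [← pow_mul, mul_comm, hxab])
      have hbez : (1 : ℤ) = a * a.gcdA b + b * a.gcdB b := by
        rw [← Nat.gcd_eq_gcd_ab, hab.gcd_eq_one, Nat.cast_one]
      rw [← zpow_one x, hbez, zpow_add, zpow_mul, zpow_mul, zpow_natCast, zpow_natCast]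
      exact mul_mem (zpow_mem h1 _) (zpow_mem h2 _)
  exact fun x hx => key (orderOf x) (orderOf_pos x) x hx (pow_orderOf_eq_one x)

end


/-- N ≤ Z_∞(G) iff for every prime p, |S_p^G(N)|_p = |N|_p. -/
theorem stmt_19 {G : Type*} [Group G] [Finite G] (N : Subgroup G) (hN : N.Normal) :
    N ≤ ⨆ n, upperCentralSeries G n ↔
      ∀ p : ℕ, p.Prime →
        p ^ (Nat.card {g : G | g ∈ N ∧ ∃ k, (Subgroup.centralizer {g}).index = p ^ k}).factorization p
          = p ^ (Nat.card ↥N).factorization p := by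
  change N ≤ ⨆ n, Subgroup.upperCentralSeries G n ↔
    ∀ p : ℕ, p.Prime → p ^ (Nat.card (primePowerClassSet N p)).factorization p =
      p ^ (Nat.card N).factorization p
  constructor
  · intro h p hp
    rw [(factorization_card_primePowerClassSet_eq_iff hp N).2 fun x hx _ => h hx]
  · intro h
    refine le_of_forall_prime_pow_mem N _ fun p hp => ?_
    exact (factorization_card_primePowerClassSet_eq_iff hp N).1
      (Nat.pow_right_injective hp.two_le (h p hp))
end
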